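/- Let a, b, c, d, e ∈ I be pairwise distinct IRIs and ?x, ?y distinct variables. The pattern ((?x, a, b) OPT (?y, c, d)) OPT (?y, d, e) is not weakly monotonic (hence non-monotonic): there exist RDF graphs G₁ ⊆ G₂ such that ⟦P⟧_{G₁} ⊑ ⟦P⟧_{G₂} fails. -/

import Mathlib

namespace SPARQL

/-- Kinds of RDF constants: IRIs, blank nodes, literals. -/
inductive Kind : Type
  | iri | blank | lit
deriving DecidableEq

/-- The countably infinite set `U` of constants, partitioned into the three
infinite sets of IRIs `I` (kind `iri`), blank nodes `B` (kind `blank`) and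
literals `L` (kind `lit`). -/
abbrev Const := Kind × ℕ

/-- The countably infinite set `V` of variables (disjoint from `U`). -/
abbrev Var := ℕ

/-- A mapping: a partial function from variables to constants with finite domain. -/
structure Mapping where
  toFun : Var → Option Const
  finite : {x : Var | toFun x ≠ none}.Finite

/-- The domain of a mapping. -/
def Mapping.dom (μ : Mapping) : Set Var := {x | μ.toFun x ≠ none}

/-- Two mappings are compatible if they agree on the intersection of their domains. -/
def Compatible (μ₁ μ₂ : Mapping) : Prop :=
  ∀ x ∈ μ₁.dom ∩ μ₂.dom, μ₁.toFun x = μ₂.toFun x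

/-- Union of two mappings (preferring the first one where both are defined). -/
def Mapping.union (μ₁ μ₂ : Mapping) : Mapping where
  toFun := fun x => match μ₁.toFun x with
    | some u => some u
    | none => μ₂.toFun x
  finite := by
    apply (μ₁.finite.union μ₂.finite).subset
    intro x hx
    simp only [Set.mem_setOf_eq] at hx
    simp only [Set.mem_union, Set.mem_setOf_eq]
    by_cases h1 : μ₁.toFun x = none
    · right; intro h2; apply hx; simp [h1, h2]
    · left; exact h1

/-- A term: either a constant or a variable. -/
inductive Term : Type
  | const : Const → Term
  | var : Var → Term

/-- A triple pattern. -/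
abbrev TriplePat := Term × Term × Term

/-- An RDF graph: a finite set of triples of constants. -/
abbrev Graph := Finset (Const × Const × Const)

/-- Variables of a term. -/
def Term.vars : Term → Set Var
  | .const _ => ∅
  | .var x => {x}

/-- Variables of a triple pattern. -/
def tripleVars (t : TriplePat) : Set Var := t.1.vars ∪ t.2.1.vars ∪ t.2.2.vars

/-- Apply a mapping to a term. -/
def Term.app (μ : Mapping) : Term → Option Const
  | .const c => some c
  | .var x => μ.toFun x

/-- Three truth values: true, false, error. -/
inductive TV : Type
  | t | f | e
deriving DecidableEq

/-- Kleene negation. -/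
def TV.neg : TV → TV
  | .t => .f
  | .f => .t
  | .e => .e

/-- Kleene conjunction. -/
def TV.and : TV → TV → TV
  | .f, _ => .f
  | _, .f => .f
  | .t, .t => .t
  | _, _ => .e

/-- Kleene disjunction. -/
def TV.or : TV → TV → TV
  | .t, _ => .t
  | _, .t => .t
  | .f, .f => .f
  | _, _ => .e

/-- Constraints: Boolean combinations of the atomic constraints
`bound(?x)`, `?x = c`, `?x = ?y`, `isIRI(?x)`, `isBlank(?x)`, `isLiteral(?x)`. -/
inductive Constraint : Type
  | bound : Var → Constraint
  | eqC : Var → Const → Constraint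
  | eqV : Var → Var → Constraint
  | isIRI : Var → Constraint
  | isBlank : Var → Constraint
  | isLiteral : Var → Constraint
  | and : Constraint → Constraint → Constraint
  | or : Constraint → Constraint → Constraint
  | not : Constraint → Constraint

/-- Three-valued evaluation of a constraint on a mapping. -/
def Constraint.eval (μ : Mapping) : Constraint → TV
  | .bound x => match μ.toFun x with
      | some _ => .t
      | none => .f
  | .eqC x c => match μ.toFun x with
      | some u => if u = c then .t else .f
      | none => .e
  | .eqV x y => match μ.toFun x, μ.toFun y with
      | some u, some v => if u = v then .t else .f
      | _, _ => .e
  | .isIRI x => match μ.toFun x with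
      | some u => if u.1 = Kind.iri then .t else .f
      | none => .e
  | .isBlank x => match μ.toFun x with
      | some u => if u.1 = Kind.blank then .t else .f
      | none => .e
  | .isLiteral x => match μ.toFun x with
      | some u => if u.1 = Kind.lit then .t else .f
      | none => .e
  | .and C D => (C.eval μ).and (D.eval μ)
  | .or C D => (C.eval μ).or (D.eval μ)
  | .not C => (C.eval μ).neg

/-- SPARQL graph patterns. -/
inductive Pattern : Type
  | triple : TriplePat → Pattern
  | and : Pattern → Pattern → Pattern
  | union : Pattern → Pattern → Pattern
  | opt : Pattern → Pattern → Pattern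
  | filter : Pattern → Constraint → Pattern

/-- `μ(t) ∈ G` for a triple pattern `t`. -/
def tripleMatch (μ : Mapping) (t : TriplePat) (G : Graph) : Prop :=
  ∃ s p o : Const, t.1.app μ = some s ∧ t.2.1.app μ = some p ∧ t.2.2.app μ = some o ∧
    (s, p, o) ∈ G

/-- Evaluation of a pattern on an RDF graph: a set of mappings. -/
def Pattern.eval (G : Graph) : Pattern → Set Mapping
  | .triple t => {μ | μ.dom = tripleVars t ∧ tripleMatch μ t G}
  | .and P₁ P₂ =>
      {μ | ∃ μ₁ ∈ P₁.eval G, ∃ μ₂ ∈ P₂.eval G, Compatible μ₁ μ₂ ∧ μ = μ₁.union μ₂}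
  | .union P₁ P₂ => P₁.eval G ∪ P₂.eval G
  | .opt P₁ P₂ =>
      {μ | ∃ μ₁ ∈ P₁.eval G, ∃ μ₂ ∈ P₂.eval G, Compatible μ₁ μ₂ ∧ μ = μ₁.union μ₂} ∪
      {μ₁ ∈ P₁.eval G | ∀ μ₂ ∈ P₂.eval G, ¬ Compatible μ₁ μ₂}
  | .filter P C => {μ ∈ P.eval G | C.eval μ = TV.t}

/-- A pattern is monotonic if enlarging the graph enlarges the answer set. -/
def Monotonic (P : Pattern) : Prop :=
  ∀ G₁ G₂ : Graph, G₁ ⊆ G₂ → P.eval G₁ ⊆ P.eval G₂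

/-- Subsumption of mappings: `μ₁ ⊑ μ₂`. -/
def Mapping.Sub (μ₁ μ₂ : Mapping) : Prop :=
  μ₁.dom ⊆ μ₂.dom ∧ ∀ x ∈ μ₁.dom, μ₁.toFun x = μ₂.toFun x

/-- Subsumption of sets of mappings: `Ω₁ ⊑ Ω₂`. -/
def SetSub (Ω₁ Ω₂ : Set Mapping) : Prop :=
  ∀ μ₁ ∈ Ω₁, ∃ μ₂ ∈ Ω₂, μ₁.Sub μ₂

/-- A pattern is weakly monotonic if enlarging the graph subsumes the old answers. -/
def WeaklyMonotonic (P : Pattern) : Prop :=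
  ∀ G₁ G₂ : Graph, G₁ ⊆ G₂ → SetSub (P.eval G₁) (P.eval G₂)

/-- Variables occurring in the triple patterns of a pattern. -/
def Pattern.vars : Pattern → Set Var
  | .triple t => tripleVars t
  | .and P Q => P.vars ∪ Q.vars
  | .union P Q => P.vars ∪ Q.vars
  | .opt P Q => P.vars ∪ Q.vars
  | .filter P _ => P.vars


/-- The singleton mapping. -/
def sing (y : Var) (s : Const) : Mapping where
  toFun := fun z => if z = y then some s else none
  finite := (Set.finite_singleton y).subset (by intro z hz; by_contra h; simp_all)

theorem mem_triple (y : Var) (p o : Const) (G : Graph) (μ : Mapping) :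
    μ ∈ (Pattern.triple (Term.var y, Term.const p, Term.const o)).eval G ↔
      ∃ s, (s, p, o) ∈ G ∧ μ = sing y s := by
  constructor
  · rintro ⟨hdom, s, p', o', h1, h2, h3, h4⟩
    simp only [Term.app, Option.some.injEq] at h1 h2 h3
    subst h2 h3
    refine ⟨s, h4, ?_⟩
    obtain ⟨f, hf⟩ := μ
    simp only [sing, Mapping.mk.injEq]
    funext z
    by_cases hz : z = y
    · subst hz; simpa using h1
    · have : z ∉ Mapping.dom ⟨f, hf⟩ := by
        rw [hdom]; simp [tripleVars, Term.vars, hz]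
      simpa [Mapping.dom, hz] using this
  · rintro ⟨s, hs, rfl⟩
    refine ⟨?_, s, p, o, ?_, rfl, rfl, hs⟩
    · ext z; simp [Mapping.dom, sing, tripleVars, Term.vars]
    · simp [Term.app, sing]

theorem compat_sing {x y : Var} (hxy : x ≠ y) (s t : Const) :
    Compatible (sing x s) (sing y t) := by
  rintro z ⟨h1, h2⟩
  simp only [Mapping.dom, sing, Set.mem_setOf_eq] at h1 h2
  by_cases h : z = x
  · subst h; simp [hxy] at h2
  · simp [h] at h1

/-- for pairwise distinct IRIs `a, b, c, d, e` and distinct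
variables `?x ≠ ?y`, the pattern `((?x, a, b) OPT (?y, c, d)) OPT (?y, d, e)`
is not weakly monotonic. -/
theorem nested_opt_not_weaklyMonotonic
    (a b c d e : Const) (ha : a.1 = Kind.iri) (hb : b.1 = Kind.iri)
    (hc : c.1 = Kind.iri) (hd : d.1 = Kind.iri) (he : e.1 = Kind.iri)
    (hdist : List.Pairwise (· ≠ ·) [a, b, c, d, e])
    (x y : Var) (hxy : x ≠ y) :
    ∃ G₁ G₂ : Graph, G₁ ⊆ G₂ ∧
      ¬ SetSub
        ((Pattern.opt
          (Pattern.opt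
            (Pattern.triple (Term.var x, Term.const a, Term.const b))
            (Pattern.triple (Term.var y, Term.const c, Term.const d)))
          (Pattern.triple (Term.var y, Term.const d, Term.const e))).eval G₁)
        ((Pattern.opt
          (Pattern.opt
            (Pattern.triple (Term.var x, Term.const a, Term.const b))
            (Pattern.triple (Term.var y, Term.const c, Term.const d)))
          (Pattern.triple (Term.var y, Term.const d, Term.const e))).eval G₂) := by
  simp only [List.pairwise_cons, List.mem_cons, List.not_mem_nil, or_false, forall_eq_or_imp,
    forall_eq] at hdist
  obtain ⟨⟨hab, hac, had, hae⟩, ⟨hbc, hbd, hbe⟩, ⟨hcd, hce⟩, hde, -⟩ := hdist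
  refine ⟨{(a, a, b), (a, d, e)}, {(a, a, b), (a, d, e), (b, c, d)}, ?_, ?_⟩
  · intro t ht
    simp only [Finset.mem_insert, Finset.mem_singleton] at ht ⊢
    tauto
  intro H
  obtain ⟨μ, hμ, hsub⟩ := H ((sing x a).union (sing y a)) (by
    refine Or.inl ⟨sing x a, Or.inr ⟨?_, ?_⟩, sing y a, ?_, compat_sing hxy a a, rfl⟩
    · rw [mem_triple]; exact ⟨a, by simp, rfl⟩
    · intro μ₂ h
      rw [mem_triple] at h
      obtain ⟨s, hs, -⟩ := h
      simp only [Finset.mem_insert, Finset.mem_singleton, Prod.mk.injEq] at hs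
      rcases hs with ⟨-, h, -⟩ | ⟨-, h, -⟩
      · exact absurd h.symm hac
      · exact absurd h hcd
    · rw [mem_triple]; exact ⟨a, by simp, rfl⟩)
  have hy : μ.toFun y = some a := by
    have h0 : ((sing x a).union (sing y a)).toFun y = some a := by
      simp [Mapping.union, sing, hxy.symm]
    rw [← h0]
    refine (hsub.2 y ?_).symm
    simp only [Mapping.dom, Set.mem_setOf_eq, h0]
    simp
  have inner : ∀ ν ∈ (Pattern.opt
            (Pattern.triple (Term.var x, Term.const a, Term.const b))
            (Pattern.triple (Term.var y, Term.const c, Term.const d))).eval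
            {(a, a, b), (a, d, e), (b, c, d)}, ν.toFun y = some b := by
    rintro ν (⟨μ₁, h1, μ₂, h2, -, rfl⟩ | ⟨h1, h2⟩)
    · rw [mem_triple] at h1 h2
      obtain ⟨s, -, rfl⟩ := h1
      obtain ⟨t, ht, rfl⟩ := h2
      simp only [Finset.mem_insert, Finset.mem_singleton, Prod.mk.injEq] at ht
      rcases ht with ⟨-, h, -⟩ | ⟨-, h, -⟩ | ⟨h, -⟩
      · exact absurd h.symm hac
      · exact absurd h hcd
      · subst h; simp [Mapping.union, sing, hxy.symm]
    · rw [mem_triple] at h1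
      obtain ⟨s, -, rfl⟩ := h1
      exact absurd (compat_sing hxy s b) (h2 _ (by rw [mem_triple]; exact ⟨b, by simp, rfl⟩))
  have hb' : μ.toFun y = some b := by
    rcases hμ with ⟨μ₁, h1, μ₂, -, -, rfl⟩ | ⟨h1, -⟩
    · simp [Mapping.union, inner _ h1]
    · exact inner _ h1
  rw [hy] at hb'
  exact hab (Option.some.inj hb')

end SPARQL
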